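/- Let t₁, t₂ ∈ ℝ. For every λ ∈ ℝ, the bracket {f, g}_λ = {f, g} + λ{f, g}', where {,} is the canonical bracket and {,}' is the bracket of the bivector π', satisfies the Jacobi identity on the open set {q₁ ≠ 0}: {f, {g, h}_λ}_λ + {g, {h, f}_λ}_λ + {h, {f, g}_λ}_λ = 0 for all smooth functions f, g, h. In particular π' is a Poisson bivector compatible with the canonical one. -/

import Mathlib

open scoped Matrix

/-- Partial derivative `∂f/∂xᵢ` of a function on ℝ⁴. -/
noncomputable def pd (f : (Fin 4 → ℝ) → ℝ) (x : Fin 4 → ℝ) (i : Fin 4) : ℝ :=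
  fderiv ℝ f x (Pi.single i 1)

/-- The canonical Poisson bracket on ℝ⁴ with coordinates
`x = (q₁, q₂, p₁, p₂)`. -/
noncomputable def cbr (f g : (Fin 4 → ℝ) → ℝ) : (Fin 4 → ℝ) → ℝ :=
  fun x => pd f x 0 * pd g x 2 + pd f x 1 * pd g x 3
    - pd f x 2 * pd g x 0 - pd f x 3 * pd g x 1

/-- The second (quadratic in momenta) bivector `π'` on `{q₁ ≠ 0}`, coordinates
`x = (q₁, q₂, p₁, p₂)`. -/
noncomputable def P'mat (t₁ t₂ : ℝ) (x : Fin 4 → ℝ) : Matrix (Fin 4) (Fin 4) ℝ :=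
  let a : ℝ := x 3 / (2 * x 0)
  let b : ℝ := x 2 / (2 * x 0) - (x 0) ^ 2 / 6 + t₁ / 2
    - ((x 3) ^ 2 / 4 + x 1 * x 3 - (x 1) ^ 2 + t₂) / (2 * (x 0) ^ 2)
  let c : ℝ := -(x 1) / x 0
  let d : ℝ := (x 0) ^ 2 - t₁ - ((x 3) ^ 2 / 4 - 3 * (x 1) ^ 2 + t₂) / (x 0) ^ 2
  !![0,  0,  a,  1;
     0,  0,  b,  c;
     -a, -b, 0,  d;
     -1, -c, -d, 0]

/-- The bracket of the bivector `π'`. -/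
noncomputable def pbr (t₁ t₂ : ℝ) (f g : (Fin 4 → ℝ) → ℝ) : (Fin 4 → ℝ) → ℝ :=
  fun x => ∑ i, ∑ j, P'mat t₁ t₂ x i j * pd f x i * pd g x j

/-- The bracket of a field `P` of bivectors on ℝ⁴. -/
noncomputable def bivectorBracket (P : (Fin 4 → ℝ) → Matrix (Fin 4) (Fin 4) ℝ)
    (f g : (Fin 4 → ℝ) → ℝ) : (Fin 4 → ℝ) → ℝ :=
  fun x => ∑ i, ∑ j, P x i j * pd f x i * pd g x j

/-- The Hessian matrix of a function on ℝ⁴. -/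
noncomputable def hessianMatrix (f : (Fin 4 → ℝ) → ℝ) (x : Fin 4 → ℝ) :
    Matrix (Fin 4) (Fin 4) ℝ :=
  fun m i => pd (fun y => pd f y i) x m

theorem differentiableAt_pd {f : (Fin 4 → ℝ) → ℝ} {x : Fin 4 → ℝ} (hf : ContDiffAt ℝ 2 f x)
    (i : Fin 4) : DifferentiableAt ℝ (fun y => pd f y i) x := by
  have : DifferentiableAt ℝ (fderiv ℝ f) x :=
    (hf.fderiv_right (m := 1) (by norm_num)).differentiableAt (by norm_num)
  unfold pd
  fun_prop

theorem hessianMatrix_isSymm {f : (Fin 4 → ℝ) → ℝ} {x : Fin 4 → ℝ} (hf : ContDiffAt ℝ 2 f x) :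
    (hessianMatrix f x).IsSymm := by
  have hd : DifferentiableAt ℝ (fderiv ℝ f) x :=
    (hf.fderiv_right (m := 1) (by norm_num)).differentiableAt (by norm_num)
  have hs : IsSymmSndFDerivAt ℝ f x := hf.isSymmSndFDerivAt (by simp)
  ext i j
  simp only [Matrix.transpose_apply, hessianMatrix, pd]
  rw [fderiv_clm_apply hd (by fun_prop), fderiv_clm_apply hd (by fun_prop)]
  simpa using hs.eq _ _

theorem pd_bivectorBracket {P : (Fin 4 → ℝ) → Matrix (Fin 4) (Fin 4) ℝ}
    {g h : (Fin 4 → ℝ) → ℝ} {x : Fin 4 → ℝ}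
    (hP : ∀ i j, DifferentiableAt ℝ (fun y => P y i j) x)
    (hg : ContDiffAt ℝ 2 g x) (hh : ContDiffAt ℝ 2 h x) (m : Fin 4) :
    pd (bivectorBracket P g h) x m = ∑ i, ∑ j,
      (pd (fun y => P y i j) x m * pd g x i * pd h x j
        + P x i j * hessianMatrix g x m i * pd h x j
        + P x i j * pd g x i * hessianMatrix h x m j) := by
  have hterm (i j : Fin 4) : HasFDerivAt (fun y => P y i j * pd g y i * pd h y j) _ x :=
    ((hP i j).hasFDerivAt.fun_mul (differentiableAt_pd hg i).hasFDerivAt).fun_mul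
      (differentiableAt_pd hh j).hasFDerivAt
  have hsum : HasFDerivAt (bivectorBracket P g h) _ x :=
    HasFDerivAt.fun_sum fun i (_ : i ∈ Finset.univ) =>
      HasFDerivAt.fun_sum fun j (_ : j ∈ Finset.univ) => hterm i j
  rw [pd, hsum.fderiv]
  simp only [sum_apply, add_apply, smul_apply, smul_eq_mul]
  refine Finset.sum_congr rfl fun i _ => Finset.sum_congr rfl fun j _ => ?_
  simp only [hessianMatrix]
  change _ * pd (fun y => pd h y j) x m + _ * (_ * pd (fun y => pd g y i) x m
    + _ * pd (fun y => P y i j) x m) = _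
  ring

theorem cyclic_sum_trilinear_eq_zero {ι R : Type*} [Fintype ι] [CommRing R]
    (J : ι → ι → ι → R) (hJ : ∀ i j k, J i j k + J j k i + J k i j = 0) (u v w : ι → R) :
    (∑ i, ∑ j, ∑ k, J i j k * u i * v j * w k) + (∑ i, ∑ j, ∑ k, J i j k * v i * w j * u k)
      + (∑ i, ∑ j, ∑ k, J i j k * w i * u j * v k) = 0 := by
  have h₁ : ∑ i, ∑ j, ∑ k, J i j k * v i * w j * u k
      = ∑ i, ∑ j, ∑ k, J j k i * v j * w k * u i := by
    rw [Finset.sum_comm_cycle]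
  have h₂ : ∑ i, ∑ j, ∑ k, J i j k * w i * u j * v k
      = ∑ i, ∑ j, ∑ k, J k i j * w k * u i * v j := by
    rw [Finset.sum_comm_cycle, Finset.sum_comm_cycle]
  rw [h₁, h₂]
  simp only [← Finset.sum_add_distrib]
  refine Finset.sum_eq_zero fun i _ => Finset.sum_eq_zero fun j _ =>
    Finset.sum_eq_zero fun k _ => ?_
  linear_combination u i * v j * w k * hJ i j k

theorem bivectorBracket_bivectorBracket {P : (Fin 4 → ℝ) → Matrix (Fin 4) (Fin 4) ℝ}
    {f g h : (Fin 4 → ℝ) → ℝ} {x : Fin 4 → ℝ}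
    (hP : ∀ i j, DifferentiableAt ℝ (fun y => P y i j) x) (hskew : (P x)ᵀ = -P x)
    (hg : ContDiffAt ℝ 2 g x) (hh : ContDiffAt ℝ 2 h x) :
    bivectorBracket P f (bivectorBracket P g h) x =
      (∑ i, ∑ j, ∑ k, (∑ m, P x i m * pd (fun y => P y j k) x m)
        * pd f x i * pd g x j * pd h x k)
      + pd f x ⬝ᵥ (P x * hessianMatrix g x * P x) *ᵥ pd h x
      - pd f x ⬝ᵥ (P x * hessianMatrix h x * P x) *ᵥ pd g x := by
  have hs (i j : Fin 4) : P x i j = -P x j i := congrFun (congrFun hskew j) i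
  have hfirst : ∑ i, ∑ j, ∑ k, (∑ m, P x i m * pd (fun y => P y j k) x m)
        * pd f x i * pd g x j * pd h x k
      = ∑ i, ∑ m, ∑ j, ∑ k, P x i m * pd f x i
        * (pd (fun y => P y j k) x m * pd g x j * pd h x k) := by
    refine Finset.sum_congr rfl fun i _ => ?_
    simp only [Finset.sum_mul]
    rw [Finset.sum_comm_cycle]
    refine Finset.sum_congr rfl fun m _ => Finset.sum_congr rfl fun j _ =>
      Finset.sum_congr rfl fun k _ => ?_
    ring
  have hsecond (G : Matrix (Fin 4) (Fin 4) ℝ) (v w : Fin 4 → ℝ) :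
      v ⬝ᵥ (P x * G * P x) *ᵥ w
        = ∑ i, ∑ m, ∑ j, ∑ k, P x i m * v i * (P x j k * G m j * w k) := by
    simp only [dotProduct, Matrix.mulVec, Matrix.mul_apply, Finset.mul_sum, Finset.sum_mul]
    refine Finset.sum_congr rfl fun i _ => ?_
    rw [Finset.sum_comm_cycle]
    refine Finset.sum_congr rfl fun m _ => ?_
    rw [Finset.sum_comm]
    refine Finset.sum_congr rfl fun j _ => Finset.sum_congr rfl fun k _ => ?_
    ring
  have hswap : ∑ i, ∑ m, ∑ j, ∑ k, P x i m * pd f x i * (P x j k * hessianMatrix h x m j * pd g x k)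
      = ∑ i, ∑ m, ∑ j, ∑ k, P x i m * pd f x i * (P x k j * hessianMatrix h x m k * pd g x j) :=
    Finset.sum_congr rfl fun i _ => Finset.sum_congr rfl fun m _ => Finset.sum_comm
  rw [hfirst, hsecond, hsecond, hswap, bivectorBracket]
  simp only [pd_bivectorBracket hP hg hh, ← Finset.sum_add_distrib, ← Finset.sum_sub_distrib,
    Finset.mul_sum]
  refine Finset.sum_congr rfl fun i _ => Finset.sum_congr rfl fun m _ =>
    Finset.sum_congr rfl fun j _ => Finset.sum_congr rfl fun k _ => ?_
  rw [hs k j]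
  ring

/-- A skew-symmetric matrix field whose Schouten bracket with itself vanishes at `x` defines a
bracket satisfying the Jacobi identity at `x`. -/
theorem bivectorBracket_jacobi {P : (Fin 4 → ℝ) → Matrix (Fin 4) (Fin 4) ℝ}
    {f g h : (Fin 4 → ℝ) → ℝ} {x : Fin 4 → ℝ}
    (hP : ∀ i j, DifferentiableAt ℝ (fun y => P y i j) x) (hskew : (P x)ᵀ = -P x)
    (hJ : ∀ i j k, (∑ m, P x i m * pd (fun y => P y j k) x m)
      + (∑ m, P x j m * pd (fun y => P y k i) x m)
      + (∑ m, P x k m * pd (fun y => P y i j) x m) = 0)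
    (hf : ContDiffAt ℝ 2 f x) (hg : ContDiffAt ℝ 2 g x) (hh : ContDiffAt ℝ 2 h x) :
    bivectorBracket P f (bivectorBracket P g h) x + bivectorBracket P g (bivectorBracket P h f) x
      + bivectorBracket P h (bivectorBracket P f g) x = 0 := by
  have hsymm {u : (Fin 4 → ℝ) → ℝ} (hu : ContDiffAt ℝ 2 u x) (v w : Fin 4 → ℝ) :
      v ⬝ᵥ (P x * hessianMatrix u x * P x) *ᵥ w = w ⬝ᵥ (P x * hessianMatrix u x * P x) *ᵥ v := by
    have : (P x * hessianMatrix u x * P x)ᵀ = P x * hessianMatrix u x * P x := by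
      simp [Matrix.transpose_mul, hskew, (hessianMatrix_isSymm hu).eq, Matrix.mul_assoc]
    rw [Matrix.dotProduct_mulVec, ← Matrix.mulVec_transpose, this, dotProduct_comm]
  rw [bivectorBracket_bivectorBracket hP hskew hg hh, bivectorBracket_bivectorBracket hP hskew hh hf,
    bivectorBracket_bivectorBracket hP hskew hf hg]
  linear_combination cyclic_sum_trilinear_eq_zero _ hJ (pd f x) (pd g x) (pd h x)
    + hsymm hf (pd h x) (pd g x) + hsymm hg (pd f x) (pd h x) + hsymm hh (pd g x) (pd f x)

/-- The matrix of the pencil of brackets spanned by the canonical bracket and `π'`. -/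
noncomputable def pencil (t₁ t₂ l : ℝ) (x : Fin 4 → ℝ) : Matrix (Fin 4) (Fin 4) ℝ :=
  !![0, 0, 1, 0; 0, 0, 0, 1; -1, 0, 0, 0; 0, -1, 0, 0] + l • P'mat t₁ t₂ x

theorem bivectorBracket_pencil (t₁ t₂ l : ℝ) (u v : (Fin 4 → ℝ) → ℝ) :
    bivectorBracket (pencil t₁ t₂ l) u v = fun y => cbr u v y + l * pbr t₁ t₂ u v y := by
  funext y
  simp only [bivectorBracket, pencil, cbr, pbr, P'mat, Fin.sum_univ_four]
  simp
  ring

theorem pencil_transpose (t₁ t₂ l : ℝ) (x : Fin 4 → ℝ) :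
    (pencil t₁ t₂ l x)ᵀ = -pencil t₁ t₂ l x := by
  ext i j
  fin_cases i <;> fin_cases j <;> simp [pencil, P'mat] <;> ring

theorem differentiableAt_pencil (t₁ t₂ l : ℝ) {x : Fin 4 → ℝ} (hx : x 0 ≠ 0) (i j : Fin 4) :
    DifferentiableAt ℝ (fun y => pencil t₁ t₂ l y i j) x := by
  have hx₁ : 2 * x 0 ≠ 0 := by simpa
  have hx₂ : x 0 ^ 2 ≠ 0 := by simpa
  have hx₃ : 2 * x 0 ^ 2 ≠ 0 := by simpa
  fin_cases i <;> fin_cases j <;> simp [pencil, P'mat] <;> fun_prop (disch := assumption)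

theorem hasFDerivAt_div {E : Type*} [NormedAddCommGroup E] [NormedSpace ℝ E] {u v : E → ℝ}
    {u' v' : E →L[ℝ] ℝ} {x : E} (hu : HasFDerivAt u u' x) (hv : HasFDerivAt v v' x)
    (hx : v x ≠ 0) :
    HasFDerivAt (fun y => u y / v y) ((v x)⁻¹ • u' - (u x / v x ^ 2) • v') x := by
  have hinv : HasFDerivAt (fun y => (v y)⁻¹) _ x := (hasDerivAt_inv hx).comp_hasFDerivAt x hv
  simp only [div_eq_mul_inv]
  refine (hu.fun_mul hinv).congr_fderiv ?_
  module

theorem hasFDerivAt_sq {E : Type*} [NormedAddCommGroup E] [NormedSpace ℝ E] {u : E → ℝ}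
    {u' : E →L[ℝ] ℝ} {x : E} (hu : HasFDerivAt u u' x) :
    HasFDerivAt (fun y => u y ^ 2) ((2 * u x) • u') x := by
  simp only [sq]
  refine (hu.fun_mul hu).congr_fderiv ?_
  module

/-- The partial derivative of the matrix `P'mat` in the direction of the `m`-th coordinate. -/
noncomputable def partialP'mat (t₂ : ℝ) (x : Fin 4 → ℝ) (m : Fin 4) :
    Matrix (Fin 4) (Fin 4) ℝ :=
  let a : ℝ := ![-x 3 / (2 * x 0 ^ 2), 0, 0, 1 / (2 * x 0)] m
  let b : ℝ := ![-x 2 / (2 * x 0 ^ 2) - x 0 / 3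
      + (x 3 ^ 2 / 4 + x 1 * x 3 - x 1 ^ 2 + t₂) / x 0 ^ 3,
    -(x 3 - 2 * x 1) / (2 * x 0 ^ 2), 1 / (2 * x 0), -(x 3 / 2 + x 1) / (2 * x 0 ^ 2)] m
  let c : ℝ := ![x 1 / x 0 ^ 2, -1 / x 0, 0, 0] m
  let d : ℝ := ![2 * x 0 + 2 * (x 3 ^ 2 / 4 - 3 * x 1 ^ 2 + t₂) / x 0 ^ 3,
    6 * x 1 / x 0 ^ 2, 0, -x 3 / (2 * x 0 ^ 2)] m
  !![0,  0,  a,  0;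
     0,  0,  b,  c;
     -a, -b, 0,  d;
     0, -c, -d, 0]

theorem pd_const (c : ℝ) (x : Fin 4 → ℝ) (m : Fin 4) : pd (fun _ => c) x m = 0 := by
  simp [pd]

theorem pd_neg (f : (Fin 4 → ℝ) → ℝ) (x : Fin 4 → ℝ) (m : Fin 4) :
    pd (fun y => -f y) x m = -pd f x m := by
  simp [pd]

theorem pd_const_add_const_mul (c l : ℝ) (f : (Fin 4 → ℝ) → ℝ) (x : Fin 4 → ℝ) (m : Fin 4) :
    pd (fun y => c + l * f y) x m = l * pd f x m := by
  have h : fderiv ℝ (fun y => l * f y) x = l • fderiv ℝ f x :=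
    congrFun (fderiv_const_smul_field (f := f) l) x
  simp [pd, h]

theorem pd_P'mat (t₁ t₂ : ℝ) {x : Fin 4 → ℝ} (hx : x 0 ≠ 0) (i j m : Fin 4) :
    pd (fun y => P'mat t₁ t₂ y i j) x m = partialP'mat t₂ x m i j := by
  have h0 := hasFDerivAt_apply (𝕜 := ℝ) (0 : Fin 4) x
  have h1 := hasFDerivAt_apply (𝕜 := ℝ) (1 : Fin 4) x
  have h2 := hasFDerivAt_apply (𝕜 := ℝ) (2 : Fin 4) x
  have h3 := hasFDerivAt_apply (𝕜 := ℝ) (3 : Fin 4) x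
  have hx₁ : 2 * x 0 ≠ 0 := by simpa
  have hx₂ : x 0 ^ 2 ≠ 0 := by simpa
  have hx₃ : 2 * x 0 ^ 2 ≠ 0 := by simpa
  have ha := hasFDerivAt_div h3 (h0.const_mul 2) hx₁
  have hb := (((hasFDerivAt_div h2 (h0.const_mul 2) hx₁).fun_sub
    ((hasFDerivAt_sq h0).mul_const 6⁻¹)).add_const (t₁ / 2)).fun_sub
      (hasFDerivAt_div (((((hasFDerivAt_sq h3).mul_const 4⁻¹).fun_add (h1.fun_mul h3)).fun_sub
        (hasFDerivAt_sq h1)).add_const t₂) ((hasFDerivAt_sq h0).const_mul 2) hx₃)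
  have hc := hasFDerivAt_div h1.fun_neg h0 hx
  have hd := ((hasFDerivAt_sq h0).sub_const t₁).fun_sub (hasFDerivAt_div
    ((((hasFDerivAt_sq h3).mul_const 4⁻¹).fun_sub ((hasFDerivAt_sq h1).const_mul 3)).add_const t₂)
      (hasFDerivAt_sq h0) hx₂)
  simp only [← div_eq_mul_inv] at hb hd
  have h₀₂ : pd (fun y => P'mat t₁ t₂ y 0 2) x m = partialP'mat t₂ x m 0 2 := by
    refine (congrArg (· (Pi.single m 1)) ha.fderiv).trans ?_
    fin_cases m <;> simp [partialP'mat]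
    field_simp
  have h₁₂ : pd (fun y => P'mat t₁ t₂ y 1 2) x m = partialP'mat t₂ x m 1 2 := by
    refine (congrArg (· (Pi.single m 1)) hb.fderiv).trans ?_
    fin_cases m <;> simp [partialP'mat] <;> field_simp <;> ring
  have h₁₃ : pd (fun y => P'mat t₁ t₂ y 1 3) x m = partialP'mat t₂ x m 1 3 := by
    refine (congrArg (· (Pi.single m 1)) hc.fderiv).trans ?_
    fin_cases m <;> simp [partialP'mat] <;> field_simp
  have h₂₃ : pd (fun y => P'mat t₁ t₂ y 2 3) x m = partialP'mat t₂ x m 2 3 := by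
    refine (congrArg (· (Pi.single m 1)) hd.fderiv).trans ?_
    fin_cases m <;> simp [partialP'mat] <;> field_simp <;> ring
  have hneg {i j : Fin 4} (hij : pd (fun y => P'mat t₁ t₂ y i j) x m = partialP'mat t₂ x m i j) :
      pd (fun y => -P'mat t₁ t₂ y i j) x m = -partialP'mat t₂ x m i j := by
    rw [pd_neg, hij]
  fin_cases i <;> fin_cases j <;>
    first
    | exact pd_const _ x m
    | exact h₀₂
    | exact h₁₂
    | exact h₁₃
    | exact h₂₃
    | exact hneg h₀₂
    | exact hneg h₁₂
    | exact hneg h₁₃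
    | exact hneg h₂₃

theorem pd_pencil (t₁ t₂ l : ℝ) {x : Fin 4 → ℝ} (hx : x 0 ≠ 0) (i j m : Fin 4) :
    pd (fun y => pencil t₁ t₂ l y i j) x m = l * partialP'mat t₂ x m i j := by
  rw [← pd_P'mat t₁ t₂ hx]
  exact pd_const_add_const_mul _ l _ x m

set_option maxHeartbeats 1000000 in
theorem pencil_schouten (t₁ t₂ l : ℝ) {x : Fin 4 → ℝ} (hx : x 0 ≠ 0) (i j k : Fin 4) :
    (∑ m, pencil t₁ t₂ l x i m * pd (fun y => pencil t₁ t₂ l y j k) x m)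
      + (∑ m, pencil t₁ t₂ l x j m * pd (fun y => pencil t₁ t₂ l y k i) x m)
      + (∑ m, pencil t₁ t₂ l x k m * pd (fun y => pencil t₁ t₂ l y i j) x m) = 0 := by
  simp only [pd_pencil t₁ t₂ l hx, Fin.sum_univ_four]
  fin_cases i <;> fin_cases j <;> fin_cases k <;> simp [pencil, P'mat, partialP'mat] <;>
    field_simp <;> ring

/-- For every `λ`, the pencil `{f,g}_λ = {f,g} + λ{f,g}'` satisfies the Jacobi
identity on the open set `{q₁ ≠ 0}`; in particular `π'` is a Poisson bivector
compatible with the canonical one. -/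
theorem stmt_14 (t₁ t₂ l : ℝ) (f g h : (Fin 4 → ℝ) → ℝ)
    (hf : ContDiffOn ℝ (⊤ : ℕ∞) f {x : Fin 4 → ℝ | x 0 ≠ 0})
    (hg : ContDiffOn ℝ (⊤ : ℕ∞) g {x : Fin 4 → ℝ | x 0 ≠ 0})
    (hh : ContDiffOn ℝ (⊤ : ℕ∞) h {x : Fin 4 → ℝ | x 0 ≠ 0})
    (x : Fin 4 → ℝ) (hx : x 0 ≠ 0) :
    let br : ((Fin 4 → ℝ) → ℝ) → ((Fin 4 → ℝ) → ℝ) → ((Fin 4 → ℝ) → ℝ) :=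
      fun u v => fun y => cbr u v y + l * pbr t₁ t₂ u v y
    br f (br g h) x + br g (br h f) x + br h (br f g) x = 0 := by
  intro br
  have hbr (u v : (Fin 4 → ℝ) → ℝ) : br u v = bivectorBracket (pencil t₁ t₂ l) u v :=
    (bivectorBracket_pencil t₁ t₂ l u v).symm
  have hnhds : {x : Fin 4 → ℝ | x 0 ≠ 0} ∈ nhds x :=
    (isOpen_ne_fun (continuous_apply 0) continuous_const).mem_nhds hx
  have hC {u : (Fin 4 → ℝ) → ℝ} (hu : ContDiffOn ℝ (⊤ : ℕ∞) u {x : Fin 4 → ℝ | x 0 ≠ 0}) :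
      ContDiffAt ℝ 2 u x :=
    (hu.contDiffAt hnhds).of_le (WithTop.coe_le_coe.2 le_top)
  simp only [hbr]
  exact bivectorBracket_jacobi (differentiableAt_pencil t₁ t₂ l hx) (pencil_transpose t₁ t₂ l x)
    (pencil_schouten t₁ t₂ l hx) (hC hf) (hC hg) (hC hh)
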